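/- arXiv:2110.09173 — 4 statements merged into one kernel-verified Lean document; each statement's English description precedes it below -/
import Mathlib

section
/- Let n ≥ 1, let 1 ≤ k ≤ n, and let α be a nonzero real number. Then the set S = { x : Fin n → ℝ | ∏_{i : Fin n, (i : ℕ) < k} x i = α }, equipped with the subspace topology from the product topology on Fin n → ℝ, is homeomorphic to the product (Fin (2^(k-1))) × (Fin (n-1) → ℝ), where Fin (2^(k-1)) carries the discrete topology. (This is the local model near a depth-k stratum of a totally real semi-stable degeneration: the nearby real fiber consists of 2^{k-1} copies of ℝ^{n-1}.) -/
open Topology in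
/-- The test `0 < f x` is locally constant when `f` is continuous and vanishes nowhere. -/
theorem continuous_decide_pos_of_ne_zero {X : Type*} [TopologicalSpace X] {f : X → ℝ}
    (hf : Continuous f) (h0 : ∀ x, f x ≠ 0) : Continuous fun x => decide (0 < f x) := by
  rw [continuous_iff_continuousAt]
  intro x
  rcases lt_or_gt_of_ne (h0 x) with h | h
  · have : (fun x => decide (0 < f x)) =ᶠ[𝓝 x] fun _ => false := by
      filter_upwards [hf.continuousAt.eventually (gt_mem_nhds h)] with y hy
      simpa using hy.le
    exact continuousAt_const.congr this.symm
  · have : (fun x => decide (0 < f x)) =ᶠ[𝓝 x] fun _ => true := by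
      filter_upwards [hf.continuousAt.eventually (lt_mem_nhds h)] with y hy
      simpa using hy
    exact continuousAt_const.congr this.symm

/-- The nonzero reals are two copies of the line, indexed by sign and parametrized by
the logarithm of the absolute value. -/
noncomputable def nonzeroHomeomorphBoolProd : {r : ℝ // r ≠ 0} ≃ₜ Bool × ℝ where
  toFun r := (decide (0 < r.1), Real.log r.1)
  invFun p := ⟨if p.1 then Real.exp p.2 else -Real.exp p.2, by
    split_ifs <;> simp [Real.exp_ne_zero]⟩
  left_inv := by
    rintro ⟨r, hr⟩
    rcases lt_or_gt_of_ne hr with h | h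
    · simp [h.not_gt, Real.exp_log_of_neg h]
    · simp [h, Real.exp_log h]
  right_inv := by
    rintro ⟨b, y⟩
    cases b <;> simp [Real.exp_pos, (Real.exp_pos y).le]
  continuous_toFun :=
    (continuous_decide_pos_of_ne_zero continuous_subtype_val fun r => r.2).prodMk
      (continuous_subtype_val.log fun r => r.2)
  continuous_invFun := by
    refine Continuous.subtype_mk (continuous_prod_of_discrete_left.2 ?_) _
    rintro (_ | _) <;> simp <;> fun_prop

theorem prod_filter_lt_succ {m : ℕ} (j : ℕ) (x : Fin (m + 1) → ℝ) :
    ∏ i ∈ Finset.univ.filter (fun i : Fin (m + 1) => (i : ℕ) < j + 1), x i =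
      x 0 * ∏ i : {i : Fin m // (i : ℕ) < j}, x i.1.succ := by
  rw [Finset.prod_filter, Fin.prod_univ_succ,
    ← Finset.prod_subtype (Finset.univ.filter fun i : Fin m => (i : ℕ) < j) (by simp)
      (fun i => x i.succ), Finset.prod_filter]
  simp

/-- A point of the fiber is determined by its coordinates other than the first one. -/
noncomputable def fiberHomeomorph (m j : ℕ) {α : ℝ} (hα : α ≠ 0) :
    ({x : Fin (m + 1) → ℝ |
        ∏ i ∈ Finset.univ.filter (fun i : Fin (m + 1) => (i : ℕ) < j + 1), x i = α} :
          Set (Fin (m + 1) → ℝ)) ≃ₜ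
      ({i : Fin m // (i : ℕ) < j} → {r : ℝ // r ≠ 0}) × ({i : Fin m // ¬ (i : ℕ) < j} → ℝ) where
  toFun x := (fun i => ⟨x.1 i.1.succ, by
    have h : _ = α := x.2
    rw [prod_filter_lt_succ] at h
    rw [← h] at hα
    exact Finset.prod_ne_zero_iff.1 (right_ne_zero_of_mul hα) i (Finset.mem_univ i)⟩,
    fun i => x.1 i.1.succ)
  invFun p := ⟨Fin.cons (α / ∏ i, (p.1 i).1)
      fun i => if h : (i : ℕ) < j then (p.1 ⟨i, h⟩).1 else p.2 ⟨i, h⟩, by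
    have h : ∏ i, (p.1 i).1 ≠ 0 := Finset.prod_ne_zero_iff.2 fun i _ => (p.1 i).2
    have hp : ∀ i : {i : Fin m // (i : ℕ) < j},
        (if h : (i.1 : ℕ) < j then (p.1 ⟨i.1, h⟩).1 else p.2 ⟨i.1, h⟩) = (p.1 i).1 :=
      fun i => dif_pos i.2
    rw [Set.mem_ofPred_eq, prod_filter_lt_succ]
    simp only [Fin.cons_zero, Fin.cons_succ, hp]
    exact div_mul_cancel₀ _ h⟩
  left_inv := by
    rintro ⟨x, hx⟩
    have h : _ = α := hx
    rw [prod_filter_lt_succ] at h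
    ext i
    refine Fin.cases ?_ (fun i => ?_) i
    · have h0 := hα
      rw [← h] at h0
      exact (eq_div_of_mul_eq (right_ne_zero_of_mul h0) h).symm
    · simp
  right_inv := by
    rintro ⟨p, q⟩
    ext i
    · exact dif_pos i.2
    · exact dif_neg i.2
  continuous_toFun :=
    (continuous_pi fun i =>
      ((continuous_apply i.1.succ).comp continuous_subtype_val).subtype_mk _).prodMk
    (continuous_pi fun i => (continuous_apply i.1.succ).comp continuous_subtype_val)
  continuous_invFun := by
    refine Continuous.subtype_mk (continuous_pi fun i => ?_) _
    refine Fin.cases ?_ (fun i => ?_) i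
    · simp only [Fin.cons_zero]
      exact continuous_const.div (by fun_prop)
        fun p => Finset.prod_ne_zero_iff.2 fun i _ => (p.1 i).2
    · simp only [Fin.cons_succ]
      split_ifs <;> fun_prop

/-- A product of nonzero lines splits into its signs and its logarithms. -/
noncomputable def piNonzeroHomeomorph (ι : Type*) :
    (ι → {r : ℝ // r ≠ 0}) ≃ₜ (ι → Bool) × (ι → ℝ) :=
  (Homeomorph.piCongrRight fun _ => nonzeroHomeomorphBoolProd).trans
    { Equiv.arrowProdEquivProdArrow ι (fun _ => Bool) (fun _ => ℝ) with
      continuous_toFun := by dsimp [Equiv.arrowProdEquivProdArrow]; fun_prop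
      continuous_invFun := by dsimp [Equiv.arrowProdEquivProdArrow]; fun_prop }

theorem card_bool_functions {m j : ℕ} (h : j ≤ m) :
    Fintype.card ({i : Fin m // (i : ℕ) < j} → Bool) = 2 ^ j := by
  have : Fintype.card {i : Fin m // (i : ℕ) < j} = j := by
    rw [Fintype.card_subtype, Fin.card_filter_val_lt, min_eq_right h]
  rw [Fintype.card_fun, Fintype.card_bool, this]

/-- The local model near a depth-`k` stratum of a totally real semi-stable degeneration:
the real nearby fiber `{x ∈ ℝⁿ | x₁ ⋯ x_k = α}` (with `α ≠ 0`) is homeomorphic to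
`2^(k-1)` disjoint copies of `ℝ^(n-1)`. -/
theorem stmt_0 (n k : ℕ) (hn : 1 ≤ n) (hk1 : 1 ≤ k) (hkn : k ≤ n)
    (α : ℝ) (hα : α ≠ 0) :
    Nonempty
      (({x : Fin n → ℝ |
          ∏ i ∈ Finset.univ.filter (fun i : Fin n => (i : ℕ) < k), x i = α} :
            Set (Fin n → ℝ)) ≃ₜ
        (Fin (2 ^ (k - 1)) × (Fin (n - 1) → ℝ))) := by
  obtain ⟨m, rfl⟩ := Nat.exists_eq_add_of_le' hn
  obtain ⟨j, rfl⟩ := Nat.exists_eq_add_of_le' hk1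
  have hjm : j ≤ m := Nat.le_of_succ_le_succ hkn
  let signs : ({i : Fin m // (i : ℕ) < j} → Bool) ≃ₜ Fin (2 ^ j) :=
    (Fintype.equivFinOfCardEq (card_bool_functions hjm)).toHomeomorphOfDiscrete
  exact ⟨(fiberHomeomorph m j hα).trans <|
    ((piNonzeroHomeomorph _).prodCongr (Homeomorph.refl _)).trans <|
    (Homeomorph.prodAssoc _ _ _).trans <|
    signs.prodCongr (Homeomorph.piEquivPiSubtypeProd (fun i : Fin m => (i : ℕ) < j)
      (fun _ => ℝ)).symm⟩
end

section
/- Let n ≥ 1, let 1 ≤ k ≤ n, and let α be a nonzero real number. Then the topological space S = { x : Fin n → ℝ | ∏_{i : Fin n, (i : ℕ) < k} x i = α }, with the subspace topology, has exactly 2^(k-1) connected components. -/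
/-- A continuous surjection onto a discrete space whose fibres lie in connected components
computes the number of connected components. -/
theorem card_connectedComponents_of_discrete {X β : Type*} [TopologicalSpace X]
    [TopologicalSpace β] [DiscreteTopology β] (f : X → β) (hf : Continuous f)
    (hsurj : Function.Surjective f)
    (hconn : ∀ x y, f x = f y → y ∈ connectedComponent x) :
    Nat.card (ConnectedComponents X) = Nat.card β := by
  refine Nat.card_congr (Equiv.ofBijective hf.connectedComponentsLift ⟨?_, ?_⟩)
  · intro a b hab
    obtain ⟨x, rfl⟩ := ConnectedComponents.surjective_coe a
    obtain ⟨y, rfl⟩ := ConnectedComponents.surjective_coe b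
    rw [hf.connectedComponentsLift_apply_coe, hf.connectedComponentsLift_apply_coe] at hab
    exact (ConnectedComponents.coe_eq_coe'.2 (hconn x y hab)).symm
  · intro b
    obtain ⟨x, rfl⟩ := hsurj b
    exact ⟨x, hf.connectedComponentsLift_apply_coe x⟩

/-- Two points with equal nonzero coordinate product over `T` lie in the same connected component
of the level set if their coordinates in `T` have pairwise equal signs. -/
theorem mem_connectedComponent_of_div_pos {ι : Type*} {T : Finset ι} {α : ℝ}
    (hα : α ≠ 0) (x y : {x : ι → ℝ | ∏ i ∈ T, x i = α})
    (hxy : ∀ i ∈ T, 0 < y.1 i / x.1 i) : y ∈ connectedComponent x := by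
  classical
  have hx : ∏ i ∈ T, x.1 i = α := x.2
  have hy : ∏ i ∈ T, y.1 i = α := y.2
  have hx0 : ∀ i ∈ T, x.1 i ≠ 0 := Finset.prod_ne_zero_iff.1 (hx.symm ▸ hα)
  let γ : ℝ → ι → ℝ := fun t i ↦
    if i ∈ T then x.1 i * (y.1 i / x.1 i) ^ t else x.1 i + t * (y.1 i - x.1 i)
  have hγ : ∀ t, γ t ∈ {x : ι → ℝ | ∏ i ∈ T, x i = α} := fun t ↦ by
    have h : ∏ i ∈ T, γ t i = ∏ i ∈ T, (x.1 i * (y.1 i / x.1 i) ^ t) :=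
      Finset.prod_congr rfl fun i hi ↦ if_pos hi
    change ∏ i ∈ T, γ t i = α
    rw [h, Finset.prod_mul_distrib, Real.finsetProd_rpow T _ fun i hi ↦ (hxy i hi).le,
      Finset.prod_div_distrib, hx, hy, div_self hα, Real.one_rpow, mul_one]
  have hcont : Continuous fun t ↦ (⟨γ t, hγ t⟩ : {x : ι → ℝ | ∏ i ∈ T, x i = α}) := by
    refine Continuous.subtype_mk (continuous_pi fun i ↦ ?_) _
    by_cases hi : i ∈ T
    · simp only [γ, if_pos hi]
      exact continuous_const.mul (Real.continuous_const_rpow (hxy i hi).ne')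
    · simp only [γ, if_neg hi]
      fun_prop
  refine (isPreconnected_range hcont).subset_connectedComponent ⟨0, ?_⟩ ⟨1, ?_⟩
  · ext i
    simp [γ]
  · ext i
    by_cases hi : i ∈ T
    · simp [γ, hi, mul_div_cancel₀ _ (hx0 i hi)]
    · simp [γ, hi]

/-- A nonzero level set of the product of the coordinates in a nonempty finite set `T`
has `2 ^ (#T - 1)` connected components. -/
theorem card_connectedComponents_prod_eq {ι : Type*} [DecidableEq ι] (T : Finset ι)
    (hT : T.Nonempty) {α : ℝ} (hα : α ≠ 0) :
    Nat.card (ConnectedComponents {x : ι → ℝ | ∏ i ∈ T, x i = α}) = 2 ^ (T.card - 1) := by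
  obtain ⟨p, hp⟩ := hT
  have hne : ∀ (x : {x : ι → ℝ | ∏ i ∈ T, x i = α}), ∀ i ∈ T, x.1 i ≠ 0 := fun x ↦
    Finset.prod_ne_zero_iff.1 (by rw [show ∏ i ∈ T, x.1 i = α from x.2]; exact hα)
  let f : {x : ι → ℝ | ∏ i ∈ T, x i = α} → (T.erase p → Bool) :=
    fun x i ↦ decide (SignType.sign (x.1 i) = 1)
  have hf : Continuous f := by
    refine continuous_pi fun i ↦ ?_
    have hs : Continuous fun x : {x : ι → ℝ | ∏ i ∈ T, x i = α} ↦ SignType.sign (x.1 i) :=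
      continuous_iff_continuousAt.2 fun x ↦
        (continuousAt_sign_of_ne_zero (hne x i (Finset.mem_of_mem_erase i.2))).comp
          (f := fun x : {x : ι → ℝ | ∏ i ∈ T, x i = α} ↦ x.1 i)
          ((continuous_apply i.1).comp continuous_subtype_val).continuousAt
    exact (continuous_of_discreteTopology (f := fun s : SignType ↦ decide (s = 1))).comp hs
  rw [card_connectedComponents_of_discrete f hf]
  · rw [Nat.card_fun, Nat.card_eq_fintype_card, Nat.card_eq_fintype_card, Fintype.card_bool,
      Fintype.card_coe, Finset.card_erase_of_mem hp]
  · intro b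
    let g : ι → ℝ := fun i ↦ if h : i ∈ T.erase p then (if b ⟨i, h⟩ then 1 else -1) else 0
    have hg : ∏ i ∈ T.erase p, g i ≠ 0 := Finset.prod_ne_zero_iff.2 fun i hi ↦ by
      simp only [g, dif_pos hi]
      split_ifs <;> norm_num
    refine ⟨⟨Function.update g p (α / ∏ i ∈ T.erase p, g i), ?_⟩, ?_⟩
    · change ∏ i ∈ T, Function.update g p (α / ∏ i ∈ T.erase p, g i) i = α
      rw [← Finset.mul_prod_erase T _ hp, Function.update_self,
        Finset.prod_congr rfl fun i hi ↦ Function.update_of_ne (Finset.ne_of_mem_erase hi) _ g,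
        div_mul_cancel₀ _ hg]
    · ext ⟨i, hi⟩
      simp only [f, Function.update_of_ne (Finset.ne_of_mem_erase hi), g, dif_pos hi]
      cases b ⟨i, hi⟩ <;> simp
  · intro x y hxy
    have hpos : ∀ i ∈ T.erase p, 0 < y.1 i / x.1 i := fun i hi ↦ by
      have h := congrFun hxy ⟨i, hi⟩
      simp only [f, decide_eq_decide, sign_eq_one_iff] at h
      have hxi := hne x i (Finset.mem_of_mem_erase hi)
      have hyi := hne y i (Finset.mem_of_mem_erase hi)
      rcases hxi.lt_or_gt with hx | hx
      · exact div_pos_of_neg_of_neg (lt_of_le_of_ne (not_lt.1 fun hy ↦ (h.2 hy).not_gt hx) hyi) hx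
      · exact div_pos (h.1 hx) hx
    refine mem_connectedComponent_of_div_pos hα x y fun i hi ↦ ?_
    by_cases hip : i = p
    · subst hip
      have h : ∏ j ∈ T, y.1 j / x.1 j = 1 := by
        rw [Finset.prod_div_distrib, show ∏ i ∈ T, x.1 i = α from x.2,
          show ∏ i ∈ T, y.1 i = α from y.2, div_self hα]
      rw [← Finset.mul_prod_erase T _ hi] at h
      exact pos_of_mul_pos_left (h ▸ one_pos) (Finset.prod_pos hpos).le
    · exact hpos i (Finset.mem_erase.2 ⟨hip, hi⟩)

/-- The real nearby fiber `{x ∈ ℝⁿ | x₁ ⋯ x_k = α}` (with `α ≠ 0`) has exactly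
`2^(k-1)` connected components. -/
theorem stmt_1 (n k : ℕ) (hn : 1 ≤ n) (hk1 : 1 ≤ k) (hkn : k ≤ n)
    (α : ℝ) (hα : α ≠ 0) :
    Nat.card
      (ConnectedComponents
        ({x : Fin n → ℝ |
          ∏ i ∈ Finset.univ.filter (fun i : Fin n => (i : ℕ) < k), x i = α} :
            Set (Fin n → ℝ))) = 2 ^ (k - 1) := by
  have hcard : (Finset.univ.filter fun i : Fin n ↦ (i : ℕ) < k).card = k := by
    rw [Fin.card_filter_val_lt, min_eq_right hkn]
  rw [card_connectedComponents_prod_eq _ (Finset.card_pos.1 (by omega)) hα, hcard]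
end

section
/- Let n ≥ 1, let 1 ≤ k ≤ n, let α be a nonzero real number, and let ε : Fin n → ℝ be such that ε i ∈ {1, -1} for every i with (i : ℕ) < k. Set S_ε = { x : Fin n → ℝ | (∏_{i, (i:ℕ)<k} x i = α) ∧ ∀ i with (i:ℕ)<k, ε i * x i > 0 }, with the subspace topology. If (∏_{i, (i:ℕ)<k} ε i) * α > 0 then S_ε is homeomorphic to Fin (n-1) → ℝ, while if (∏_{i, (i:ℕ)<k} ε i) * α < 0 then S_ε is empty. -/
/-- The product over the first `k` coordinates splits off the zeroth factor. -/
theorem prod_filter_val_lt_succ {m k : ℕ} (hk : 1 ≤ k) (f : Fin (m + 1) → ℝ) :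
    ∏ i ∈ Finset.univ.filter (fun i : Fin (m + 1) => (i : ℕ) < k), f i =
      f 0 * ∏ j : Fin m, if ((j.succ : Fin (m + 1)) : ℕ) < k then f j.succ else 1 := by
  have h0 : 0 < k := hk
  rw [Finset.prod_filter, Fin.prod_univ_succ]
  simp [h0]

/-- A vector whose signs on `s` are prescribed by `ε` has product of sign `∏ ε`. -/
theorem prod_mul_prod_pos {ι : Type*} (s : Finset ι) (ε x : ι → ℝ)
    (h : ∀ i ∈ s, 0 < ε i * x i) : 0 < (∏ i ∈ s, ε i) * ∏ i ∈ s, x i := by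
  rw [← Finset.prod_mul_distrib]
  exact Finset.prod_pos h

/-- The coordinates after the zeroth, with the first ones parametrized by signed exponentials. -/
noncomputable def signedExpTail {m : ℕ} (k : ℕ) (ε : Fin (m + 1) → ℝ) (y : Fin m → ℝ) :
    Fin m → ℝ :=
  fun j => if ((j.succ : Fin (m + 1)) : ℕ) < k then ε j.succ * Real.exp (y j) else y j

/-- The product of the first coordinates of `signedExpTail`. -/
noncomputable def signedExpTailProd {m : ℕ} (k : ℕ) (ε : Fin (m + 1) → ℝ) (y : Fin m → ℝ) : ℝ :=
  ∏ j : Fin m, if ((j.succ : Fin (m + 1)) : ℕ) < k then signedExpTail k ε y j else 1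

theorem continuous_signedExpTail {m : ℕ} (k : ℕ) (ε : Fin (m + 1) → ℝ) :
    Continuous (signedExpTail k ε) := by
  refine continuous_pi fun j => ?_
  unfold signedExpTail
  split_ifs <;> fun_prop

theorem continuous_signedExpTailProd {m : ℕ} (k : ℕ) (ε : Fin (m + 1) → ℝ) :
    Continuous (signedExpTailProd k ε) := by
  refine continuous_finsetProd _ fun j _ => ?_
  split_ifs
  · exact (continuous_apply j).comp (continuous_signedExpTail k ε)
  · exact continuous_const

/-- The signs of the tail and of its product agree. -/
theorem signedExpTailProd_pos {m k : ℕ} {ε : Fin (m + 1) → ℝ}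
    (hε : ∀ i : Fin (m + 1), (i : ℕ) < k → ε i * ε i = 1) (y : Fin m → ℝ) :
    0 < (∏ j : Fin m, if ((j.succ : Fin (m + 1)) : ℕ) < k then ε j.succ else 1) *
      signedExpTailProd k ε y := by
  refine prod_mul_prod_pos _ _ _ fun j _ => ?_
  unfold signedExpTail
  split_ifs with h
  · rw [← mul_assoc, hε _ h, one_mul]
    exact Real.exp_pos _
  · norm_num

/-- A branch of `x₁ ⋯ x_k = α` is a graph over its last coordinates, and logarithms of the
signed ones identify it with a real coordinate space. -/
noncomputable def branchHomeomorph {m k : ℕ} (hk : 1 ≤ k) {α : ℝ} {ε : Fin (m + 1) → ℝ}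
    (hε : ∀ i : Fin (m + 1), (i : ℕ) < k → ε i * ε i = 1)
    (hα : 0 < (∏ i ∈ Finset.univ.filter (fun i : Fin (m + 1) => (i : ℕ) < k), ε i) * α) :
    ({x : Fin (m + 1) → ℝ |
        (∏ i ∈ Finset.univ.filter (fun i : Fin (m + 1) => (i : ℕ) < k), x i = α) ∧
        ∀ i : Fin (m + 1), (i : ℕ) < k → ε i * x i > 0} : Set (Fin (m + 1) → ℝ)) ≃ₜ
      (Fin m → ℝ) where
  toFun x j := if ((j.succ : Fin (m + 1)) : ℕ) < k then
    Real.log (ε j.succ * x.1 j.succ) else x.1 j.succ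
  invFun y := ⟨Fin.cons (α / signedExpTailProd k ε y) (signedExpTail k ε y), by
    have hpos := signedExpTailProd_pos hε y
    have hne : signedExpTailProd k ε y ≠ 0 := right_ne_zero_of_mul hpos.ne'
    refine ⟨?_, fun i => Fin.cases (fun _ => ?_) (fun j hj => ?_) i⟩
    · rw [prod_filter_val_lt_succ hk]
      exact div_mul_cancel₀ α hne
    · rw [prod_filter_val_lt_succ hk] at hα
      have hne' := left_ne_zero_of_mul hpos.ne'
      rw [Fin.cons_zero]
      refine lt_of_lt_of_eq (div_pos hα hpos) ?_
      field_simp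
    · rw [Fin.cons_succ, signedExpTail, if_pos hj, ← mul_assoc, hε _ hj, one_mul]
      exact Real.exp_pos _⟩
  left_inv := by
    rintro ⟨x, hx, hs⟩
    have htail : signedExpTail k ε (fun j => if ((j.succ : Fin (m + 1)) : ℕ) < k then
        Real.log (ε j.succ * x j.succ) else x j.succ) = fun j => x j.succ := by
      funext j
      unfold signedExpTail
      split_ifs with h
      · beta_reduce; rw [if_pos h, Real.exp_log (hs _ h), ← mul_assoc, hε _ h, one_mul]
      · beta_reduce; rw [if_neg h]
    apply Subtype.ext
    funext i
    refine Fin.cases ?_ (fun j => ?_) i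
    · have hne := (signedExpTailProd_pos hε (fun j => if ((j.succ : Fin (m + 1)) : ℕ) < k then
        Real.log (ε j.succ * x j.succ) else x j.succ)).ne'
      replace hne := right_ne_zero_of_mul hne
      dsimp only
      rw [Fin.cons_zero, div_eq_iff hne, signedExpTailProd, htail, ← hx,
        prod_filter_val_lt_succ hk]
    · dsimp only
      rw [Fin.cons_succ, htail]
  right_inv y := by
    funext j
    dsimp only
    rw [Fin.cons_succ, signedExpTail]
    split_ifs with h
    · rw [← mul_assoc, hε _ h, one_mul, Real.log_exp]
    · rfl
  continuous_toFun := by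
    refine continuous_pi fun j => ?_
    have hc : Continuous fun x : {x : Fin (m + 1) → ℝ |
        (∏ i ∈ Finset.univ.filter (fun i : Fin (m + 1) => (i : ℕ) < k), x i = α) ∧
        ∀ i : Fin (m + 1), (i : ℕ) < k → ε i * x i > 0} => x.1 j.succ :=
      (continuous_apply _).comp continuous_subtype_val
    split_ifs with h
    · exact (continuous_const.mul hc).log fun x => (x.2.2 _ h).ne'
    · exact hc
  continuous_invFun := by
    refine Continuous.subtype_mk (continuous_pi fun i => Fin.cases ?_ (fun j => ?_) i) _
    · exact continuous_const.div (continuous_signedExpTailProd k ε) fun y =>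
        right_ne_zero_of_mul (signedExpTailProd_pos hε y).ne'
    · exact (continuous_apply j).comp (continuous_signedExpTail k ε)


/-- For a sign vector `ε` on the first `k` coordinates, the branch
`S_ε = {x | x₁ ⋯ x_k = α, sign of x_i prescribed by ε}` of the real nearby fiber is
homeomorphic to `ℝ^(n-1)` if `(∏ ε_i) · α > 0`, and empty if `(∏ ε_i) · α < 0`. -/
theorem stmt_2 (n k : ℕ) (hn : 1 ≤ n) (hk1 : 1 ≤ k) (hkn : k ≤ n)
    (α : ℝ) (hα : α ≠ 0) (ε : Fin n → ℝ)
    (hε : ∀ i : Fin n, (i : ℕ) < k → ε i = 1 ∨ ε i = -1) :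
    ((∏ i ∈ Finset.univ.filter (fun i : Fin n => (i : ℕ) < k), ε i) * α > 0 →
      Nonempty
        (({x : Fin n → ℝ |
            (∏ i ∈ Finset.univ.filter (fun i : Fin n => (i : ℕ) < k), x i = α) ∧
            ∀ i : Fin n, (i : ℕ) < k → ε i * x i > 0} : Set (Fin n → ℝ)) ≃ₜ
          (Fin (n - 1) → ℝ))) ∧
    ((∏ i ∈ Finset.univ.filter (fun i : Fin n => (i : ℕ) < k), ε i) * α < 0 →
      ({x : Fin n → ℝ |
          (∏ i ∈ Finset.univ.filter (fun i : Fin n => (i : ℕ) < k), x i = α) ∧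
          ∀ i : Fin n, (i : ℕ) < k → ε i * x i > 0} : Set (Fin n → ℝ)) = ∅) := by
  obtain ⟨m, rfl⟩ : ∃ m, n = m + 1 := ⟨n - 1, by omega⟩
  have hsq : ∀ i : Fin (m + 1), (i : ℕ) < k → ε i * ε i = 1 := fun i hi => by
    rcases hε i hi with h | h <;> rw [h] <;> norm_num
  refine ⟨fun h => ⟨branchHomeomorph hk1 hsq h⟩, fun h => ?_⟩
  refine Set.eq_empty_iff_forall_notMem.2 fun x hx => ?_
  have hpos := prod_mul_prod_pos (Finset.univ.filter fun i : Fin (m + 1) => (i : ℕ) < k) ε x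
    fun i hi => hx.2 i (Finset.mem_filter.1 hi).2
  rw [hx.1] at hpos
  exact lt_asymm h hpos
end

section
/- Let K be a field and n a natural number. There is a bijection between the projective space ℙ(K, Fin (n+1) → K) (the projectivization of the vector space K^{n+1}) and the disjoint union Σ_{i : Fin (n+1)}, (Fin (i : ℕ) → K) of the affine spaces K^0, K^1, …, K^n. (This is the stratification of projective n-space by affine spaces used to show that real projective spaces satisfy χ = σ via the scissor relation.) -/
/-- The vector `(a₀, …, aᵢ₋₁, 1, 0, …, 0)` in `K^(n+1)`, the normalized representative of the point
of the `i`-dimensional affine cell of projective `n`-space with coordinates `a`. -/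
def affineCellVector {K : Type*} [Field K] {n : ℕ}
    (x : Σ i : Fin (n + 1), (Fin (i : ℕ) → K)) : Fin (n + 1) → K :=
  fun j => if h : (j : ℕ) < x.1 then x.2 ⟨j, h⟩ else if j = x.1 then 1 else 0

section

variable {K : Type*} [Field K] {n : ℕ}

theorem affineCellVector_of_lt (x : Σ i : Fin (n + 1), (Fin (i : ℕ) → K)) {j : Fin (n + 1)}
    (h : (j : ℕ) < x.1) : affineCellVector x j = x.2 ⟨j, h⟩ := by
  simp [affineCellVector, h]

@[simp]
theorem affineCellVector_self (x : Σ i : Fin (n + 1), (Fin (i : ℕ) → K)) :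
    affineCellVector x x.1 = 1 := by
  simp [affineCellVector]

theorem affineCellVector_of_gt (x : Σ i : Fin (n + 1), (Fin (i : ℕ) → K)) {j : Fin (n + 1)}
    (h : x.1 < j) : affineCellVector x j = 0 := by
  have h' : ¬ (j : ℕ) < x.1 := not_lt.2 (Fin.le_def.1 h.le)
  simp [affineCellVector, h', h.ne']

theorem affineCellVector_ne_zero (x : Σ i : Fin (n + 1), (Fin (i : ℕ) → K)) :
    affineCellVector x ≠ 0 := fun h => by
  simpa using congrFun h x.1

/-- Proportional normalized vectors come from the same point of the same cell. -/
theorem eq_of_smul_affineCellVector_eq {x y : Σ i : Fin (n + 1), (Fin (i : ℕ) → K)} {c : K}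
    (h : c • affineCellVector y = affineCellVector x) : x = y := by
  have hc : c ≠ 0 := by
    rintro rfl
    exact affineCellVector_ne_zero x (by rw [← h, zero_smul])
  have hj (j : Fin (n + 1)) : c * affineCellVector y j = affineCellVector x j := congrFun h j
  have hxy : x.1 = y.1 := by
    rcases lt_trichotomy x.1 y.1 with hlt | heq | hgt
    · have := hj y.1
      rw [affineCellVector_self, affineCellVector_of_gt x hlt, mul_one] at this
      exact absurd this hc
    · exact heq
    · have := hj x.1
      rw [affineCellVector_self, affineCellVector_of_gt y hgt, mul_zero] at this
      exact absurd this zero_ne_one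
  obtain ⟨i, a⟩ := x
  obtain ⟨i', b⟩ := y
  obtain rfl : i = i' := hxy
  have hc1 : c = 1 := by
    have := hj i
    rwa [affineCellVector_self ⟨i, a⟩, affineCellVector_self ⟨i, b⟩, mul_one] at this
  subst hc1
  congr 1
  funext k
  have := hj ⟨k, k.2.trans i.2⟩
  rw [affineCellVector_of_lt ⟨i, a⟩ k.2, affineCellVector_of_lt ⟨i, b⟩ k.2, one_mul] at this
  exact this.symm

/-- Every nonzero vector is a multiple of a normalized one: divide by the last nonzero entry. -/
theorem exists_smul_affineCellVector_eq {v : Fin (n + 1) → K} (hv : v ≠ 0) :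
    ∃ (x : Σ i : Fin (n + 1), (Fin (i : ℕ) → K)) (c : K), c • v = affineCellVector x := by
  obtain ⟨i, hi : v i ≠ 0, hmax⟩ :=
    (Set.toFinite {i | v i ≠ 0}).exists_maximal (Function.ne_iff.1 hv)
  refine ⟨⟨i, fun k => (v i)⁻¹ * v ⟨k, k.2.trans i.2⟩⟩, (v i)⁻¹, ?_⟩
  funext j
  rcases lt_trichotomy j i with hlt | rfl | hgt
  · rw [affineCellVector_of_lt _ hlt]
    rfl
  · rw [affineCellVector_self ⟨j, _⟩]
    exact inv_mul_cancel₀ hi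
  · have hj : v j = 0 := by
      by_contra hj
      exact (hmax hj hgt.le).not_gt hgt
    rw [affineCellVector_of_gt _ hgt, Pi.smul_apply, hj, smul_zero]

end

/-- Projective `n`-space over a field `K` is stratified by affine spaces:
`ℙ(K, K^(n+1))` is in bijection with `K^0 ⊔ K^1 ⊔ ⋯ ⊔ K^n`. -/
theorem stmt_5 (K : Type*) [Field K] (n : ℕ) :
    Nonempty
      (Projectivization K (Fin (n + 1) → K) ≃ Σ i : Fin (n + 1), (Fin (i : ℕ) → K)) := by
  refine ⟨(Equiv.ofBijective
    (fun x => Projectivization.mk K (affineCellVector x) (affineCellVector_ne_zero x))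
    ⟨fun x y h => ?_, fun p => ?_⟩).symm⟩
  · obtain ⟨c, hc⟩ := (Projectivization.mk_eq_mk_iff' K _ _ _ _).1 h
    exact eq_of_smul_affineCellVector_eq hc
  · induction p with
    | h v hv =>
      obtain ⟨x, c, hc⟩ := exists_smul_affineCellVector_eq hv
      exact ⟨x, (Projectivization.mk_eq_mk_iff' K _ _ _ _).2 ⟨c, hc⟩⟩
end
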